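/- Let k ≥ 1, a ≥ 1, b ≥ 0 and c ≥ 1 be integers, d := gcd(a, b), a' := a/d. Then g_{k,φ} is periodic, and its smallest period P_{k,φ} equals Q_{k,a',c}, except when there exists an odd prime p with p ∤ a' and v_p(k+1) ≥ v_p(L_k) ≥ 1 (there is at most one such prime), in which case P_{k,φ} = Q_{k,a',c} / p^{v_p(L_k)}. Here Q_{k,a',c} := c·L_k / (η_{2,k,a',c} · ∏_{q prime, q | a'} q^{v_q(c·L_k)}), and η_{2,k,a',c} := 2^{v_2(L_k)} if 2 ∤ a' and v_2(k+1) ≥ v_2(L_k) ≥ 2; η_{2,k,a',c} := 2 if (2 ∤ a and v_2(c·L_k) = 1), or (k = 3, 2 ∤ a and 2 | c), or (k = 3, 2 ∤ a' and 2 | d); and η_{2,k,a',c} := 1 otherwise. -/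

import Mathlib

/-- `L k = lcm (1, 2, …, k)`. -/
def Lk (k : ℕ) : ℕ := (Finset.Icc 1 k).lcm id

/-- `g_{k,φ} (n) = (∏_{i=0}^{k} φ (b + a (n + i c))) / φ (lcm_{0 ≤ i ≤ k} (b + a (n + i c)))`. -/
def gkphi (k a b c n : ℕ) : ℚ :=
  (∏ i ∈ Finset.range (k + 1), ((b + a * (n + i * c)).totient : ℚ)) /
    (((Finset.range (k + 1)).lcm fun i => b + a * (n + i * c)).totient : ℚ)

/-- The factor `η_{2,k,a',c}` of Theorem 1.3. -/
def eta2 (k a c d a' : ℕ) : ℕ :=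
  if ¬ 2 ∣ a' ∧ 2 ≤ padicValNat 2 (Lk k) ∧
      padicValNat 2 (Lk k) ≤ padicValNat 2 (k + 1) then
    2 ^ padicValNat 2 (Lk k)
  else if (¬ 2 ∣ a ∧ padicValNat 2 (c * Lk k) = 1) ∨
      (k = 3 ∧ ¬ 2 ∣ a ∧ 2 ∣ c) ∨ (k = 3 ∧ ¬ 2 ∣ a' ∧ 2 ∣ d) then 2
  else 1

/-- `Q_{k,a',c} = c L_k / (η_{2,k,a',c} ⬝ ∏_{q prime, q ∣ a'} q ^ v_q (c L_k))`. -/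
def Qval (k a c d a' : ℕ) : ℕ :=
  c * Lk k /
    (eta2 k a c d a' *
      ∏ q ∈ a'.divisors.filter Nat.Prime, q ^ padicValNat q (c * Lk k))

/-- The quotient `∏ φ (p ^ e i) / φ (p ^ max e)` over `0 ≤ i ≤ k`. -/
def totientRatio (p k : ℕ) (e : ℕ → ℕ) : ℚ :=
  (∏ i ∈ Finset.range (k + 1), ((p ^ e i).totient : ℚ)) /
    ((p ^ (Finset.range (k + 1)).sup e).totient : ℚ)

lemma totient_prime_pow_pos {p : ℕ} (hp : p.Prime) (e : ℕ) : 0 < ((p ^ e).totient : ℚ) := by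
  exact_mod_cast Nat.totient_pos.2 (pow_pos hp.pos e)

lemma totientRatio_pos {p : ℕ} (hp : p.Prime) (k : ℕ) (e : ℕ → ℕ) : 0 < totientRatio p k e :=
  div_pos (Finset.prod_pos fun _ _ => totient_prime_pow_pos hp _) (totient_prime_pow_pos hp _)

lemma totientRatio_congr {p k : ℕ} {e e' : ℕ → ℕ} (h : ∀ i ≤ k, e i = e' i) :
    totientRatio p k e = totientRatio p k e' := by
  have h' : ∀ i ∈ Finset.range (k + 1), e i = e' i := fun i hi =>
    h i (Nat.lt_succ_iff.1 (Finset.mem_range.1 hi))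
  unfold totientRatio
  rw [Finset.prod_congr rfl fun i hi => by rw [h' i hi], Finset.sup_congr rfl h']

lemma totientRatio_eq_prod_erase {p k : ℕ} (hp : p.Prime) {e : ℕ → ℕ} {j : ℕ} (hj : j ≤ k)
    (hmax : ∀ i ≤ k, e i ≤ e j) :
    totientRatio p k e = ∏ i ∈ (Finset.range (k + 1)).erase j, ((p ^ e i).totient : ℚ) := by
  have hjm : j ∈ Finset.range (k + 1) := Finset.mem_range.2 (Nat.lt_succ_iff.2 hj)
  have hsup : (Finset.range (k + 1)).sup e = e j :=
    le_antisymm (Finset.sup_le fun i hi => hmax i (Nat.lt_succ_iff.1 (Finset.mem_range.1 hi)))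
      (Finset.le_sup hjm)
  rw [totientRatio, hsup, ← Finset.mul_prod_erase _ _ hjm,
    mul_div_cancel_left₀ _ (totient_prime_pow_pos hp _).ne']

/-- Truncating the exponents at `N` does not change the ratio when at most one exceeds `N`. -/
lemma totientRatio_min {p k : ℕ} (hp : p.Prime) {e : ℕ → ℕ} {N : ℕ}
    (h : ∀ i ≤ k, ∀ j ≤ k, N < e i → N < e j → i = j) :
    totientRatio p k e = totientRatio p k (fun i => min (e i) N) := by
  obtain ⟨j, hj, hmax⟩ := Finset.exists_max_image (Finset.range (k + 1)) e ⟨0, by simp⟩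
  simp only [Finset.mem_range, Nat.lt_succ_iff] at hj hmax
  rw [totientRatio_eq_prod_erase hp hj hmax, totientRatio_eq_prod_erase hp hj
    (fun i hi => min_le_min_right N (hmax i hi))]
  refine Finset.prod_congr rfl fun i hi => ?_
  simp only [Finset.mem_erase, Finset.mem_range, Nat.lt_succ_iff] at hi
  have : e i ≤ N := by
    by_contra! hN
    exact hi.1 (h i hi.2 j hj hN (hN.trans_le (hmax i hi.2)))
  rw [min_eq_left this]

lemma totientRatio_succ {p k : ℕ} {e : ℕ → ℕ} (h : e (k + 1) = e 0) :
    totientRatio p k (fun i => e (i + 1)) = totientRatio p k e := by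
  have hsup : (Finset.range (k + 1)).sup (fun i => e (i + 1)) = (Finset.range (k + 1)).sup e := by
    apply le_antisymm
    · refine Finset.sup_le fun i hi => ?_
      rw [Finset.mem_range] at hi
      rcases Nat.lt_or_ge (i + 1) (k + 1) with hi' | hi'
      · exact Finset.le_sup (f := e) (Finset.mem_range.2 hi')
      · rw [show i + 1 = k + 1 by omega, h]
        exact Finset.le_sup (f := e) (Finset.mem_range.2 k.succ_pos)
    · refine Finset.sup_le fun i hi => ?_
      rw [Finset.mem_range] at hi
      rcases i with _ | i
      · rw [← h]
        exact Finset.le_sup (f := fun i => e (i + 1)) (Finset.mem_range.2 k.lt_succ_self)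
      · exact Finset.le_sup (f := fun i => e (i + 1)) (Finset.mem_range.2 (by omega))
  rw [totientRatio, totientRatio, hsup, Finset.prod_range_succ, Finset.prod_range_succ', h]

lemma totient_eq_prod_of_subset {m : ℕ} (hm : m ≠ 0) {U : Finset ℕ} (hU : m.primeFactors ⊆ U) :
    m.totient = ∏ p ∈ U, (p ^ m.factorization p).totient := by
  rw [Nat.multiplicative_factorization Nat.totient (fun _ _ => Nat.totient_mul) Nat.totient_one hm]
  exact Finsupp.prod_of_support_subset _ (by simpa using hU) _ (by simp)

lemma factorization_finset_lcm {ι : Type*} (s : Finset ι) (w : ι → ℕ) (hw : ∀ i ∈ s, w i ≠ 0)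
    (p : ℕ) : (s.lcm w).factorization p = s.sup fun i => (w i).factorization p := by
  classical
  induction s using Finset.induction_on with
  | empty => simp
  | insert i s his ih =>
    have hs : ∀ i ∈ s, w i ≠ 0 := fun i hi => hw i (Finset.mem_insert_of_mem hi)
    have h0 : s.lcm w ≠ 0 := by simpa [Finset.lcm_eq_zero_iff] using hs
    rw [Finset.lcm_insert, Finset.sup_insert, ← ih hs]
    change (Nat.lcm _ _).factorization p = _
    rw [Nat.factorization_lcm (hw i (Finset.mem_insert_self i s)) h0]
    rfl

lemma prod_totient_div_totient_lcm (k : ℕ) (w : ℕ → ℕ) (hw : ∀ i, w i ≠ 0) {U : Finset ℕ}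
    (hU : ((Finset.range (k + 1)).lcm w).primeFactors ⊆ U) :
    (∏ i ∈ Finset.range (k + 1), ((w i).totient : ℚ)) /
      (((Finset.range (k + 1)).lcm w).totient : ℚ) =
    ∏ p ∈ U, totientRatio p k fun i => (w i).factorization p := by
  have h0 : (Finset.range (k + 1)).lcm w ≠ 0 := by
    simpa [Finset.lcm_eq_zero_iff] using fun i _ => hw i
  have hUi : ∀ i ∈ Finset.range (k + 1), (w i).primeFactors ⊆ U := fun i hi =>
    (Nat.primeFactors_mono (Finset.dvd_lcm hi) h0).trans hU
  simp only [totientRatio, Finset.prod_div_distrib]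
  rw [Finset.prod_comm, totient_eq_prod_of_subset h0 hU]
  congr 1
  · refine Finset.prod_congr rfl fun i hi => ?_
    rw [totient_eq_prod_of_subset (hw i) (hUi i hi)]
    push_cast
    rfl
  · push_cast
    refine Finset.prod_congr rfl fun p _ => ?_
    rw [factorization_finset_lcm _ _ fun i _ => hw i]

lemma min_factorization_add {p : ℕ} (hp : p.Prime) {x y N : ℕ} (hx : x ≠ 0) (hy : p ^ N ∣ y) :
    min ((x + y).factorization p) N = min (x.factorization p) N := by
  have key : ∀ t ≤ N, (t ≤ (x + y).factorization p ↔ t ≤ x.factorization p) := fun t ht => by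
    rw [← hp.pow_dvd_iff_le_factorization hx, ← hp.pow_dvd_iff_le_factorization (by omega)]
    exact (Nat.dvd_add_iff_left ((pow_dvd_pow p ht).trans hy)).symm
  refine eq_of_forall_le_iff fun t => ?_
  rw [le_min_iff, le_min_iff]
  exact ⟨fun h => ⟨(key t h.2).1 h.1, h.2⟩, fun h => ⟨(key t h.2).2 h.1, h.2⟩⟩

lemma Function.Periodic.of_dvd {α : Type*} {f : ℕ → α} {S T : ℕ} (h : Function.Periodic f S)
    (hST : S ∣ T) : Function.Periodic f T := by
  obtain ⟨m, rfl⟩ := hST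
  simpa [mul_comm] using h.nat_mul m

lemma Function.Periodic.gcd {α : Type*} {f : ℕ → α} {S T : ℕ} (hS : Function.Periodic f S)
    (hT : Function.Periodic f T) : Function.Periodic f (S.gcd T) := by
  rcases Nat.eq_zero_or_pos T with rfl | hT0
  · simpa using hS
  rcases (Nat.le_of_dvd hT0 (Nat.gcd_dvd_right S T)).lt_or_eq with h | h
  · obtain ⟨m, -, hm⟩ := Nat.exists_mul_mod_eq_gcd h
    intro n
    calc f (n + S.gcd T) = f (n + S.gcd T + T * (S * m / T)) := (hT.of_dvd (Dvd.intro _ rfl) _).symm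
      _ = f (n + S * m) := by rw [← hm, add_assoc, Nat.mod_add_div]
      _ = f n := hS.of_dvd (Dvd.intro m rfl) n
  · rwa [h]

/-- A product of positive functions `f p`, each with smallest period a power of the prime `p`,
has all its periods divisible by the product of these powers. -/
lemma prod_pow_dvd_of_periodic {S : Finset ℕ} (hS : ∀ p ∈ S, p.Prime) {f : ℕ → ℕ → ℚ}
    (hf : ∀ p ∈ S, ∀ n, 0 < f p n) {e : ℕ → ℕ}
    (hper : ∀ p ∈ S, Function.Periodic (f p) (p ^ e p))
    (hmin : ∀ p ∈ S, e p ≠ 0 → ¬ Function.Periodic (f p) (p ^ (e p - 1)))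
    {T : ℕ} (hT : Function.Periodic (fun n => ∏ p ∈ S, f p n) T) : ∏ p ∈ S, p ^ e p ∣ T := by
  refine Finset.prod_dvd_of_isRelPrime (fun p hp q hq hpq => ?_) fun p hp => ?_
  · exact Nat.coprime_iff_isRelPrime.1 (Nat.coprime_pow_primes _ _ (hS p hp) (hS q hq) hpq)
  by_contra hdvd
  have he : e p ≠ 0 := fun h => hdvd (by simp [h])
  set M := ∏ q ∈ S.erase p, q ^ e q with hM
  have hcop : Nat.Coprime (p ^ e p) M := Nat.Coprime.prod_right fun q hq =>
    Nat.coprime_pow_primes _ _ (hS p hp) (hS q (Finset.mem_of_mem_erase hq))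
      (Finset.ne_of_mem_erase hq).symm
  have hTM : Function.Periodic (f p) (T * M) := fun n => by
    have h := hT.of_dvd (Dvd.intro M rfl) n
    simp only [← Finset.mul_prod_erase S _ hp] at h
    rw [Finset.prod_congr rfl fun q hq => (hper q (Finset.mem_of_mem_erase hq)).of_dvd
      ((Finset.dvd_prod_of_mem _ hq).trans (Dvd.intro_left T rfl)) n] at h
    exact mul_right_cancel₀ (Finset.prod_pos fun q hq => hf q (Finset.mem_of_mem_erase hq) n).ne' h
  have hg := (hper p hp).gcd hTM
  obtain ⟨s, hs, hgs⟩ := (Nat.dvd_prime_pow (hS p hp)).1 (Nat.gcd_dvd_left (p ^ e p) (T * M))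
  rw [hgs] at hg
  refine hmin p hp he (hg.of_dvd (pow_dvd_pow p ?_))
  rcases hs.lt_or_eq with h | h
  · omega
  · refine absurd ?_ hdvd
    rw [h] at hgs
    exact hcop.dvd_of_dvd_mul_right (Nat.gcd_eq_left_iff_dvd.1 hgs)

lemma Lk_ne_zero (k : ℕ) : Lk k ≠ 0 := by
  simp [Lk, Finset.lcm_eq_zero_iff]

lemma factorization_le_of_le {p k j : ℕ} (hj : 1 ≤ j) (hjk : j ≤ k) :
    j.factorization p ≤ (Lk k).factorization p :=
  (Nat.factorization_le_iff_dvd (d := j) (by omega) (Lk_ne_zero k)).2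
    (Finset.dvd_lcm (f := id) (Finset.mem_Icc.2 ⟨hj, hjk⟩)) p

lemma pow_factorization_Lk_le {p k : ℕ} (hk : 1 ≤ k) : p ^ (Lk k).factorization p ≤ k := by
  have h := factorization_finset_lcm (Finset.Icc 1 k) id
    (fun i hi => by have := (Finset.mem_Icc.1 hi).1; simp only [id]; omega) p
  obtain ⟨j, hj, hjs⟩ := Finset.exists_mem_eq_sup (Finset.Icc 1 k) ⟨1, by simpa using hk⟩
    fun i => (id i).factorization p
  rw [Finset.mem_Icc] at hj
  rw [Lk, h, hjs]
  exact (Nat.ordProj_le (n := j) p (by omega)).trans hj.2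

lemma lt_pow_factorization_Lk_succ {p k : ℕ} (hp : p.Prime) :
    k < p ^ ((Lk k).factorization p + 1) := by
  by_contra! h
  have := factorization_le_of_le (p := p) (Nat.one_le_pow _ _ hp.pos) h
  simp [hp.factorization_pow] at this

/-- The local factor at `p` of `n ↦ gkphi k a b c n`. -/
def localFactor (k a b c p n : ℕ) : ℚ :=
  totientRatio p k fun i => (b + a * (n + i * c)).factorization p

lemma localFactor_pos {p : ℕ} (hp : p.Prime) (k a b c n : ℕ) : 0 < localFactor k a b c p n :=
  totientRatio_pos hp _ _

lemma localFactor_const {k a b c p : ℕ} (hp : p.Prime) (hb : b ≠ 0)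
    (hab : b.factorization p < a.factorization p) (n m : ℕ) :
    localFactor k a b c p n = localFactor k a b c p m := by
  have key : ∀ x, (b + a * x).factorization p = b.factorization p := fun x => by
    have h := min_factorization_add hp (y := a * x) hb
      (((pow_dvd_pow p hab).trans (Nat.ordProj_dvd a p)).mul_right x)
    omega
  simp only [localFactor, key]

/-- The level `p ^ truncLevel` beyond which valuations do not influence the local factor. -/
def truncLevel (k a c p : ℕ) : ℕ :=
  a.factorization p + c.factorization p + (Lk k).factorization p

/-- Truncated valuations of the terms of the progression. -/
def truncVal (k a b c p n : ℕ) : ℕ :=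
  min ((b + a * n).factorization p) (truncLevel k a c p)

lemma localFactor_eq_trunc {k a b c p : ℕ} (hp : p.Prime) (ha : a ≠ 0) (hb : b ≠ 0) (hc : c ≠ 0)
    (n : ℕ) : localFactor k a b c p n =
      totientRatio p k fun i => truncVal k a b c p (n + i * c) := by
  refine totientRatio_min hp ?_
  have key : ∀ i ≤ k, ∀ j ≤ k, i < j →
      truncLevel k a c p < (b + a * (n + i * c)).factorization p →
      truncLevel k a c p < (b + a * (n + j * c)).factorization p → False := by
    intro i hi j hj hij h1 h2
    have d1 := (hp.pow_dvd_iff_le_factorization (by omega)).2 (Nat.succ_le_of_lt h1)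
    have d2 := (hp.pow_dvd_iff_le_factorization (by omega)).2 (Nat.succ_le_of_lt h2)
    have hsub : b + a * (n + j * c) = b + a * (n + i * c) + a * c * (j - i) := by
      obtain ⟨t, rfl⟩ := Nat.exists_eq_add_of_lt hij
      rw [show i + t + 1 - i = t + 1 by omega]
      ring
    rw [hsub, ← Nat.dvd_add_iff_right d1, hp.pow_dvd_iff_le_factorization
      (mul_ne_zero (mul_ne_zero ha hc) (by omega)),
      Nat.factorization_mul (mul_ne_zero ha hc) (by omega), Nat.factorization_mul ha hc] at d2
    have := factorization_le_of_le (p := p) (k := k) (j := j - i) (by omega) (by omega)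
    simp only [Finsupp.add_apply, truncLevel] at d2
    omega
  intro i hi j hj h1 h2
  rcases lt_trichotomy i j with h | h | h
  · exact (key i hi j hj h h1 h2).elim
  · exact h
  · exact (key j hj i hi h h2 h1).elim

lemma truncVal_add {k a b c p n m : ℕ} (hp : p.Prime) (hb : b ≠ 0)
    (hm : p ^ (c.factorization p + (Lk k).factorization p) ∣ m) :
    truncVal k a b c p (n + m) = truncVal k a b c p n := by
  rw [truncVal, mul_add, ← add_assoc]
  refine min_factorization_add hp (by omega) ?_
  rw [truncLevel, add_assoc, pow_add]
  exact mul_dvd_mul (Nat.ordProj_dvd a p) hm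

lemma localFactor_periodic {k a b c p : ℕ} (hp : p.Prime) (ha : a ≠ 0) (hb : b ≠ 0) (hc : c ≠ 0) :
    Function.Periodic (localFactor k a b c p)
      (p ^ (c.factorization p + (Lk k).factorization p)) := fun n => by
  rw [localFactor_eq_trunc hp ha hb hc, localFactor_eq_trunc hp ha hb hc]
  refine totientRatio_congr fun i _ => ?_
  rw [add_right_comm, truncVal_add hp hb dvd_rfl]

lemma localFactor_periodic_of_le {k a b c p : ℕ} (hp : p.Prime) (ha : a ≠ 0) (hb : b ≠ 0)
    (hc : c ≠ 0) (h : (Lk k).factorization p ≤ (k + 1).factorization p) :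
    Function.Periodic (localFactor k a b c p) (p ^ c.factorization p) := by
  have hper : Function.Periodic (localFactor k a b c p) c := fun n => by
    rw [localFactor_eq_trunc hp ha hb hc, localFactor_eq_trunc hp ha hb hc,
      ← totientRatio_succ (e := fun i => truncVal k a b c p (n + i * c))]
    · refine totientRatio_congr fun i _ => congrArg _ ?_
      ring
    · rw [zero_mul, add_zero, truncVal_add hp hb]
      rw [add_comm, pow_add]
      exact mul_dvd_mul ((pow_dvd_pow p h).trans (Nat.ordProj_dvd _ p)) (Nat.ordProj_dvd c p)
  have hg := hper.gcd (localFactor_periodic (k := k) (a := a) (b := b) hp ha hb hc)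
  refine hg.of_dvd ?_
  obtain ⟨s, hs, hgs⟩ := (Nat.dvd_prime_pow hp).1 (Nat.gcd_dvd_right c
    (p ^ (c.factorization p + (Lk k).factorization p)))
  rw [hgs]
  refine pow_dvd_pow p ((hp.pow_dvd_iff_le_factorization hc).1 ?_)
  rw [← hgs]
  exact Nat.gcd_dvd_left _ _

lemma localFactor_eq_one {k a b c p : ℕ} (hp : p.Prime) (ha : a ≠ 0) (hb : b ≠ 0) (hc : c ≠ 0)
    (h : (p ^ truncLevel k a c p).totient = 1) (n : ℕ) : localFactor k a b c p n = 1 := by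
  have hone : ∀ m, (p ^ truncVal k a b c p m).totient = 1 := fun m =>
    Nat.dvd_one.1 (h ▸ Nat.totient_dvd_of_dvd (pow_dvd_pow p (min_le_right _ _)))
  obtain ⟨j, -, hj⟩ := Finset.exists_mem_eq_sup (Finset.range (k + 1)) ⟨0, by simp⟩
    fun i => truncVal k a b c p (n + i * c)
  simp [localFactor_eq_trunc hp ha hb hc, totientRatio, hj, hone]

lemma exists_pow_dvd_add_mul {a b p N : ℕ} (hp : p.Prime) (ha : a ≠ 0) (hb : b ≠ 0)
    (hab : a.factorization p ≤ b.factorization p) : ∃ n, p ^ (a.factorization p + N) ∣ b + a * n := by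
  rcases Nat.eq_zero_or_pos N with rfl | hN
  · exact ⟨0, by simpa using (hp.pow_dvd_iff_le_factorization hb).2 hab⟩
  obtain ⟨b', hb'⟩ := (hp.pow_dvd_iff_le_factorization hb).2 hab
  set a' := a / p ^ a.factorization p with ha'
  have haa : a = p ^ a.factorization p * a' := (Nat.ordProj_mul_ordCompl_eq_self a p).symm
  have hcop : Nat.Coprime a' (p ^ N) := (Nat.coprime_ordCompl hp ha).symm.pow_right N
  obtain ⟨x, -, hx⟩ := Nat.exists_mul_mod_eq_one_of_coprime hcop (Nat.one_lt_pow hN.ne' hp.one_lt)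
  refine ⟨x * (b' * (p ^ N - 1)), ?_⟩
  have : b + a * (x * (b' * (p ^ N - 1))) =
      p ^ a.factorization p * (b' + (a' * x) * (b' * (p ^ N - 1))) := by
    rw [mul_assoc a', mul_add, ← mul_assoc _ a', ← haa, ← hb']
  rw [this, pow_add]
  refine mul_dvd_mul_left _ ?_
  have h1 : p ^ N - 1 + 1 = p ^ N := Nat.sub_add_cancel (Nat.one_le_pow _ _ hp.pos)
  rw [← Nat.mod_add_div (a' * x) (p ^ N), hx]
  refine ⟨b' * (1 + a' * x / p ^ N * (p ^ N - 1)), ?_⟩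
  generalize p ^ N - 1 = q at *
  rw [← h1]
  ring

lemma totient_prime_pow_mono {p : ℕ} (hp : p.Prime) {x y : ℕ} (h : x ≤ y) :
    (p ^ x).totient ≤ (p ^ y).totient :=
  Nat.le_of_dvd (Nat.totient_pos.2 (pow_pos hp.pos y)) (Nat.totient_dvd_of_dvd (pow_dvd_pow p h))

lemma totient_prime_pow_pred_lt {p N : ℕ} (hp : p.Prime) (hN : N ≠ 0) (h : ¬(p = 2 ∧ N = 1)) :
    (p ^ (N - 1)).totient < (p ^ N).totient := by
  obtain ⟨N, rfl⟩ := Nat.exists_eq_succ_of_ne_zero hN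
  have h2 := hp.two_le
  rcases N with _ | N
  · simp [Nat.totient_prime hp]
    omega
  · simp only [Nat.succ_eq_add_one, Nat.add_sub_cancel, Nat.totient_prime_pow_succ hp]
    exact Nat.mul_lt_mul_of_pos_right (Nat.pow_lt_pow_right hp.one_lt N.lt_succ_self) (by omega)

section Minimality

variable {k a b c p n : ℕ}

lemma le_truncVal_add_iff (hp : p.Prime) (hb : b ≠ 0)
    (hn : p ^ truncLevel k a c p ∣ b + a * n) (m t : ℕ) :
    t ≤ truncVal k a b c p (n + m) ↔ t ≤ truncLevel k a c p ∧ p ^ t ∣ a * m := by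
  rw [truncVal, le_min_iff, and_comm, ← hp.pow_dvd_iff_le_factorization (by omega), mul_add,
    ← add_assoc]
  exact and_congr_right fun ht => (Nat.dvd_add_iff_right ((pow_dvd_pow p ht).trans hn)).symm

lemma not_periodic_pow_pred (hp : p.Prime) (ha : a ≠ 0) (hb : b ≠ 0)
    (hc : c ≠ 0) (hk : 1 ≤ k) (hn : p ^ truncLevel k a c p ∣ b + a * n)
    (hN : c.factorization p ≠ 0)
    (hlt : (p ^ (truncLevel k a c p - 1)).totient < (p ^ truncLevel k a c p).totient) :
    ¬ Function.Periodic (localFactor k a b c p) (p ^ (c.factorization p - 1)) := by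
  intro hper
  set x := a.factorization p + c.factorization p - 1 with hx
  have hxl : x + 1 ≤ truncLevel k a c p := by simp only [truncLevel]; omega
  have hac : ∀ i, p ^ (x + 1) ∣ a * (i * c) := fun i => by
    rw [show x + 1 = a.factorization p + c.factorization p by omega, pow_add]
    exact mul_dvd_mul (Nat.ordProj_dvd a p) ((Nat.ordProj_dvd c p).mul_left i)
  have hlow : ∀ i, x ≤ truncVal k a b c p (n + i * c) := fun i =>
    (le_truncVal_add_iff hp hb hn _ _).2 ⟨by omega, (pow_dvd_pow p x.le_succ).trans (hac i)⟩
  have hconst : ∀ i, truncVal k a b c p (n + p ^ (c.factorization p - 1) + i * c) = x := fun i => by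
    rw [add_assoc]
    refine le_antisymm (Nat.lt_succ_iff.1 (not_le.1 ?_)) ?_
    · rw [Nat.succ_eq_add_one, le_truncVal_add_iff hp hb hn, mul_add,
        ← Nat.dvd_add_iff_left (hac i),
        hp.pow_dvd_iff_le_factorization (mul_ne_zero ha (pow_pos hp.pos _).ne'),
        Nat.factorization_mul ha (pow_pos hp.pos _).ne', hp.factorization_pow]
      simp only [Finsupp.add_apply, Finsupp.single_eq_same]
      omega
    · refine (le_truncVal_add_iff hp hb hn _ _).2 ⟨by omega, ?_⟩
      rw [mul_add]
      refine dvd_add ?_ ((pow_dvd_pow p x.le_succ).trans (hac i))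
      rw [hx, Nat.add_sub_assoc (by omega), pow_add]
      exact mul_dvd_mul_right (Nat.ordProj_dvd a p) _
  have htop : ∀ i, p ^ (Lk k).factorization p ∣ i →
      truncVal k a b c p (n + i * c) = truncLevel k a c p := fun i hi => by
    refine le_antisymm (min_le_right _ _) ((le_truncVal_add_iff hp hb hn _ _).2 ⟨le_rfl, ?_⟩)
    rw [truncLevel, add_assoc, pow_add, add_comm (c.factorization p), pow_add]
    exact mul_dvd_mul (Nat.ordProj_dvd a p) (mul_dvd_mul hi (Nat.ordProj_dvd c p))
  have h := hper n
  rw [localFactor_eq_trunc hp ha hb hc, localFactor_eq_trunc hp ha hb hc] at h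
  simp only [hconst] at h
  rw [totientRatio_eq_prod_erase hp k.zero_le (fun _ _ => le_rfl),
    totientRatio_eq_prod_erase hp k.zero_le
      (fun i _ => by rw [htop 0 (dvd_zero _)]; exact min_le_right _ _)] at h
  refine (Finset.prod_lt_prod (fun _ _ => totient_prime_pow_pos hp _)
    (fun i _ => ?_) ⟨p ^ (Lk k).factorization p, ?_, ?_⟩).ne h
  · exact_mod_cast totient_prime_pow_mono hp (hlow i)
  · have := pow_factorization_Lk_le (p := p) hk
    exact Finset.mem_erase.2 ⟨(pow_pos hp.pos _).ne', Finset.mem_range.2 (by omega)⟩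
  · rw [htop _ dvd_rfl]
    exact_mod_cast (totient_prime_pow_mono hp (show x ≤ truncLevel k a c p - 1 by omega)).trans_lt
      hlt

lemma not_periodic_of_factorization_succ_lt (hp : p.Prime) (ha : a ≠ 0) (hb : b ≠ 0)
    (hc : c ≠ 0) (hk : 1 ≤ k) (hn : p ^ truncLevel k a c p ∣ b + a * n)
    (hL : (k + 1).factorization p < (Lk k).factorization p)
    (hlt : (p ^ (truncLevel k a c p - 1)).totient < (p ^ truncLevel k a c p).totient) :
    ¬ Function.Periodic (localFactor k a b c p)
      (p ^ (c.factorization p + (Lk k).factorization p - 1)) := by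
  intro hper
  set l := (Lk k).factorization p with hl
  set T : ℕ → ℕ := fun j => truncVal k a b c p (n + j * c) with hT
  have hTiff : ∀ j t, t ≤ T j ↔ t ≤ truncLevel k a c p ∧ p ^ t ∣ a * (j * c) := fun j t =>
    le_truncVal_add_iff hp hb hn (j * c) t
  have hle : ∀ j, T j ≤ truncLevel k a c p := fun j => min_le_right _ _
  have hshift : ∀ m, localFactor k a b c p (n + m * c) = totientRatio p k fun i => T (m + i) := by
    intro m
    rw [localFactor_eq_trunc hp ha hb hc]
    refine totientRatio_congr fun i _ => congrArg _ ?_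
    ring
  have hsup : ∀ m, (Finset.range (k + 1)).sup (fun i => T (m + i)) = truncLevel k a c p := by
    intro m
    refine le_antisymm (Finset.sup_le fun i _ => hle _) ?_
    have hlk : p ^ l ≤ k := pow_factorization_Lk_le hk
    obtain ⟨r, q, rfl, hr⟩ : ∃ r q, m = r + p ^ l * q ∧ r < p ^ l :=
      ⟨m % p ^ l, m / p ^ l, (Nat.mod_add_div m _).symm, Nat.mod_lt _ (pow_pos hp.pos l)⟩
    refine le_trans ?_ (Finset.le_sup (f := fun i => T (r + p ^ l * q + i))
      (Finset.mem_range.2 (show p ^ l - r < k + 1 by omega)))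
    refine (hTiff _ _).2 ⟨le_rfl, ?_⟩
    rw [truncLevel, ← hl, add_assoc, pow_add, add_comm (c.factorization p), pow_add]
    refine mul_dvd_mul (Nat.ordProj_dvd a p) (mul_dvd_mul ?_ (Nat.ordProj_dvd c p))
    exact ⟨q + 1, by rw [mul_add, mul_one]; omega⟩
  have hrec : ∀ m, localFactor k a b c p (n + (m + 1) * c) * (p ^ T m).totient =
      localFactor k a b c p (n + m * c) * (p ^ T (m + k + 1)).totient := by
    intro m
    rw [hshift, hshift, totientRatio, totientRatio, hsup, hsup, div_mul_eq_mul_div,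
      div_mul_eq_mul_div]
    congr 1
    have h1 := Finset.prod_range_succ (fun i => ((p ^ T (m + i)).totient : ℚ)) (k + 1)
    have h2 := Finset.prod_range_succ' (fun i => ((p ^ T (m + i)).totient : ℚ)) (k + 1)
    rw [h1] at h2
    simp only [add_zero, ← add_assoc] at h2 ⊢
    rw [h2]
    refine congrArg (· * _) (Finset.prod_congr rfl fun i _ => ?_)
    rw [add_right_comm]
  set P := p ^ (l - 1) with hP
  have hdvd : p ^ (c.factorization p + l - 1) ∣ P * c := by
    rw [show c.factorization p + l - 1 = l - 1 + c.factorization p by omega, pow_add]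
    exact mul_dvd_mul_left _ (Nat.ordProj_dvd c p)
  have hPper : ∀ m, localFactor k a b c p (n + (P + m) * c) = localFactor k a b c p (n + m * c) :=
    fun m => by
      rw [← hper.of_dvd hdvd (n + m * c)]
      congr 1
      ring
  have e0 := hrec 0
  have e1 := hrec P
  have hP0 := hPper 0
  rw [hPper 1] at e1
  rw [add_zero] at hP0
  rw [hP0] at e1
  rw [zero_add, zero_add] at e0
  have hT0 : T 0 = truncLevel k a c p :=
    le_antisymm (hle 0) ((hTiff 0 _).2 ⟨le_rfl, by simp⟩)
  have hPc : p ^ (truncLevel k a c p - 1) ∣ a * (P * c) := by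
    rw [show truncLevel k a c p - 1 = a.factorization p + (c.factorization p + l - 1) by
      simp only [truncLevel]; omega, pow_add]
    exact mul_dvd_mul (Nat.ordProj_dvd a p) hdvd
  have hTP : T P = truncLevel k a c p - 1 := by
    have h1 := (hTiff P _).2 ⟨Nat.sub_le _ _, hPc⟩
    have h2 : ¬ truncLevel k a c p ≤ T P := by
      have hP0 : P ≠ 0 := (pow_pos hp.pos _).ne'
      rw [hTiff, hp.pow_dvd_iff_le_factorization (mul_ne_zero ha (mul_ne_zero hP0 hc)),
        Nat.factorization_mul ha (mul_ne_zero hP0 hc), Nat.factorization_mul hP0 hc, hP,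
        hp.factorization_pow]
      simp only [Finsupp.add_apply, Finsupp.single_eq_same, truncLevel]
      omega
    omega
  have hTk : T (k + 1) ≤ T (P + k + 1) := by
    have h := (hTiff (k + 1) _).1 le_rfl
    refine (hTiff _ _).2 ⟨h.1, ?_⟩
    rw [add_assoc, add_mul, mul_add]
    refine dvd_add ((pow_dvd_pow p ?_).trans hPc) h.2
    have h2 := h.2
    rw [hp.pow_dvd_iff_le_factorization (mul_ne_zero ha (mul_ne_zero k.succ_ne_zero hc)),
      Nat.factorization_mul ha (mul_ne_zero k.succ_ne_zero hc),
      Nat.factorization_mul k.succ_ne_zero hc] at h2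
    simp only [Finsupp.add_apply, Nat.succ_eq_add_one, truncLevel] at h2 ⊢
    omega
  rw [hT0] at e0
  rw [hTP] at e1
  have hlt' : ((p ^ (truncLevel k a c p - 1)).totient : ℚ) < (p ^ truncLevel k a c p).totient := by
    exact_mod_cast hlt
  have hmono : ((p ^ T (k + 1)).totient : ℚ) ≤ (p ^ T (P + k + 1)).totient := by
    exact_mod_cast totient_prime_pow_mono hp hTk
  have hG := localFactor_pos hp k a b c (n + 0 * c)
  have hkey : ((p ^ T (k + 1)).totient : ℚ) * (p ^ (truncLevel k a c p - 1)).totient =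
      (p ^ T (P + k + 1)).totient * (p ^ truncLevel k a c p).totient := by
    refine mul_left_cancel₀ hG.ne' ?_
    rw [← mul_assoc, ← e0, ← mul_assoc, ← e1]
    ring
  exact (mul_lt_mul' hmono hlt' (totient_prime_pow_pos hp _).le
    (totient_prime_pow_pos hp _)).ne hkey

end Minimality

/-- The exponent of `p` in the smallest period of the local factor at `p`. -/
def localExp (k a b c p : ℕ) : ℕ :=
  if b.factorization p < a.factorization p then 0
  else if 1 ≤ (Lk k).factorization p ∧ (Lk k).factorization p ≤ (k + 1).factorization p then
    c.factorization p
  else if p = 2 ∧ truncLevel k a c p = 1 then 0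
  else c.factorization p + (Lk k).factorization p

lemma localFactor_periodic_localExp {k a b c p : ℕ} (hp : p.Prime) (ha : a ≠ 0) (hb : b ≠ 0)
    (hc : c ≠ 0) : Function.Periodic (localFactor k a b c p) (p ^ localExp k a b c p) := by
  unfold localExp
  split_ifs with h1 h2 h3
  · exact fun n => localFactor_const hp hb h1 _ _
  · exact localFactor_periodic_of_le hp ha hb hc h2.2
  · have h : (p ^ truncLevel k a c p).totient = 1 := by simp [h3.1, h3.1 ▸ h3.2]
    exact fun n => by simp only [localFactor_eq_one hp ha hb hc h]
  · exact localFactor_periodic hp ha hb hc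

lemma not_periodic_localExp_sub_one {k a b c p : ℕ} (hk : 1 ≤ k) (hp : p.Prime) (ha : a ≠ 0)
    (hb : b ≠ 0) (hc : c ≠ 0) (h0 : localExp k a b c p ≠ 0) :
    ¬ Function.Periodic (localFactor k a b c p) (p ^ (localExp k a b c p - 1)) := by
  have h1 : ¬ b.factorization p < a.factorization p := fun h => h0 (if_pos h)
  obtain ⟨n, hn⟩ := exists_pow_dvd_add_mul (N := c.factorization p + (Lk k).factorization p)
    hp ha hb (not_lt.1 h1)
  rw [← add_assoc] at hn
  rw [localExp, if_neg h1] at h0 ⊢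
  have hlt (h : ¬(p = 2 ∧ truncLevel k a c p = 1))
      (h' : c.factorization p + (Lk k).factorization p ≠ 0) :=
    totient_prime_pow_pred_lt hp (N := truncLevel k a c p)
      (by rw [truncLevel]; omega) h
  by_cases h2 : 1 ≤ (Lk k).factorization p ∧ (Lk k).factorization p ≤ (k + 1).factorization p
  · rw [if_pos h2] at h0 ⊢
    exact not_periodic_pow_pred hp ha hb hc hk hn h0
      (hlt (by rw [truncLevel]; omega) (by omega))
  · rw [if_neg h2] at h0 ⊢
    have h3 : ¬(p = 2 ∧ truncLevel k a c p = 1) := fun h => h0 (if_pos h)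
    rw [if_neg h3] at h0 ⊢
    by_cases hL : (Lk k).factorization p = 0
    · rw [hL, add_zero] at h0 ⊢
      exact not_periodic_pow_pred hp ha hb hc hk hn h0 (hlt h3 (by omega))
    · exact not_periodic_of_factorization_succ_lt hp ha hb hc hk hn (by omega) (hlt h3 h0)

lemma gkphi_succ {k a b c : ℕ} (ha : a ≠ 0) (hc : c ≠ 0) (n : ℕ) :
    gkphi k a b c (n + 1) =
      ∏ p ∈ (a * c * Lk k).primeFactors, localFactor k a (b + a) c p n := by
  have h0 : a * c * Lk k ≠ 0 := mul_ne_zero (mul_ne_zero ha hc) (Lk_ne_zero k)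
  have hw : ∀ i, b + a * (n + 1 + i * c) = b + a + a * (n + i * c) := fun i => by ring
  simp only [gkphi, hw]
  rw [prod_totient_div_totient_lcm k _ (fun i => by omega) (Finset.subset_union_right
    (s₁ := (a * c * Lk k).primeFactors))]
  refine (Finset.prod_subset Finset.subset_union_left fun p hpU hpS => ?_).symm
  have hp : p.Prime := Nat.prime_of_mem_primeFactors
    ((Finset.mem_union.1 hpU).resolve_left hpS)
  refine localFactor_eq_one hp ha (by omega) hc ?_ n
  have hdvd : ¬ p ∣ a * c * Lk k := fun h => hpS (Nat.mem_primeFactors.2 ⟨hp, h, h0⟩)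
  have := Nat.factorization_eq_zero_of_not_dvd hdvd
  rw [Nat.factorization_mul (mul_ne_zero ha hc) (Lk_ne_zero k), Nat.factorization_mul ha hc] at this
  rw [truncLevel, ← Finsupp.add_apply, ← Finsupp.add_apply, this]
  simp

lemma prime_dvd_div_gcd_iff {a b p : ℕ} (hp : p.Prime) (ha : a ≠ 0) (hb : b ≠ 0) :
    p ∣ a / a.gcd b ↔ b.factorization p < a.factorization p := by
  have h0 : a / a.gcd b ≠ 0 :=
    (Nat.div_pos (Nat.gcd_le_left b (Nat.pos_of_ne_zero ha)) (Nat.gcd_pos_of_pos_left b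
      (Nat.pos_of_ne_zero ha))).ne'
  rw [hp.dvd_iff_one_le_factorization h0, Nat.factorization_div (Nat.gcd_dvd_left a b),
    Nat.factorization_gcd ha hb]
  simp only [Finsupp.tsub_apply, Finsupp.inf_apply]
  omega

lemma factorization_prod_prime_pow {S : Finset ℕ} (hS : ∀ p ∈ S, p.Prime) (f : ℕ → ℕ) (q : ℕ) :
    (∏ p ∈ S, p ^ f p).factorization q = if q ∈ S then f q else 0 := by
  rw [Nat.factorization_prod fun p hp => (pow_pos (hS p hp).pos _).ne', Finsupp.finsetSum_apply,
    Finset.sum_congr rfl fun p hp => by rw [(hS p hp).factorization_pow, Finsupp.single_apply]]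
  simp

lemma eq_three_of_factorization_two_Lk {k : ℕ} (h : (Lk k).factorization 2 = 1)
    (h' : 1 ≤ (k + 1).factorization 2) : k = 3 := by
  have h1 := lt_pow_factorization_Lk_succ (k := k) Nat.prime_two
  rw [h] at h1
  have h2 : 2 ∣ k + 1 := Nat.dvd_of_factorization_pos (by omega)
  have h3 : k ≠ 1 := by
    rintro rfl
    simp [Lk] at h
  omega

lemma eta2_eq {k a b c : ℕ} (ha : a ≠ 0) (hb : b ≠ 0) (hc : c ≠ 0) :
    eta2 k a c (a.gcd b) (a / a.gcd b) =
      if b.factorization 2 < a.factorization 2 then 1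
      else 2 ^ (c.factorization 2 + (Lk k).factorization 2 - localExp k a b c 2) := by
  have hL3 : (Lk 3).factorization 2 = 1 := by
    have h1 := lt_pow_factorization_Lk_succ (k := 3) Nat.prime_two
    have h2 := pow_factorization_Lk_le (p := 2) (k := 3) (by norm_num)
    generalize (Lk 3).factorization 2 = l at *
    rcases l with _ | _ | l
    · norm_num at h1
    · rfl
    · have := Nat.one_le_two_pow (n := l)
      rw [pow_add] at h2
      omega
  have h4 : (3 + 1).factorization 2 = 2 := by
    rw [show 3 + 1 = 2 ^ 2 by norm_num, Nat.prime_two.factorization_pow]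
    simp
  have hd : 2 ∣ a.gcd b ↔ 2 ∣ a ∧ 2 ∣ b := Nat.dvd_gcd_iff
  have e : ∀ n, n ≠ 0 → (2 ∣ n ↔ 1 ≤ n.factorization 2) := fun n hn =>
    Nat.prime_two.dvd_iff_one_le_factorization hn
  simp only [eta2, localExp, ← Nat.factorization_def _ Nat.prime_two,
    prime_dvd_div_gcd_iff Nat.prime_two ha hb, hd, e a ha, e b hb, e c hc,
    Nat.factorization_mul hc (Lk_ne_zero k), Finsupp.add_apply, truncLevel]
  have h3 := eq_three_of_factorization_two_Lk (k := k)
  have h5 : k = 3 → (Lk k).factorization 2 = 1 ∧ (k + 1).factorization 2 = 2 := by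
    rintro rfl
    exact ⟨hL3, h4⟩
  generalize (Lk k).factorization 2 = l at *
  generalize (k + 1).factorization 2 = s at *
  generalize a.factorization 2 = α at *
  generalize b.factorization 2 = β at *
  generalize c.factorization 2 = γ at *
  clear hL3 h4 e hd
  by_cases hk3 : k = 3
  · obtain ⟨rfl, rfl⟩ := h5 hk3
    simp only [hk3]
    grind
  · simp only [hk3]
    grind

lemma exceptional_prime_unique {k p q : ℕ} (hp : p.Prime) (hq : q.Prime)
    (hp1 : 1 ≤ (Lk k).factorization p) (hp2 : (Lk k).factorization p ≤ (k + 1).factorization p)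
    (hq1 : 1 ≤ (Lk k).factorization q) (hq2 : (Lk k).factorization q ≤ (k + 1).factorization q) :
    p = q := by
  by_contra hne
  have key : ∀ {p q : ℕ}, p.Prime → q.Prime → p ≠ q →
      1 ≤ (Lk k).factorization p → 1 ≤ (Lk k).factorization q →
      (Lk k).factorization p ≤ (k + 1).factorization p →
      (Lk k).factorization q ≤ (k + 1).factorization q → q ≤ p := by
    intro p q hp hq hne hp1 hq1 hp2 hq2
    have hdvd : p ^ (Lk k).factorization p * q ^ (Lk k).factorization q ∣ k + 1 :=
      (Nat.coprime_pow_primes _ _ hp hq hne).mul_dvd_of_dvd_of_dvd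
        ((pow_dvd_pow p hp2).trans (Nat.ordProj_dvd _ p))
        ((pow_dvd_pow q hq2).trans (Nat.ordProj_dvd _ q))
    have h1 := (Nat.le_of_dvd k.succ_pos hdvd).trans (lt_pow_factorization_Lk_succ (k := k) hp)
    rw [pow_succ] at h1
    exact (Nat.le_self_pow (by omega) q).trans
      (Nat.le_of_mul_le_mul_left h1 (pow_pos hp.pos _))
  exact hne (le_antisymm (key hq hp (Ne.symm hne) hq1 hp1 hq2 hp2) (key hp hq hne hp1 hq1 hp2 hq2))

/-- `X` collects the contribution of the odd exceptional prime. -/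
lemma Qval_eq {k a b c : ℕ} (ha : a ≠ 0) (hb : b ≠ 0) (hc : c ≠ 0) {X : ℕ} (hX0 : X ≠ 0)
    (hX : ∀ q, q.Prime → X.factorization q =
      if q ≠ 2 ∧ ¬ b.factorization q < a.factorization q ∧ 1 ≤ (Lk k).factorization q ∧
        (Lk k).factorization q ≤ (k + 1).factorization q then (Lk k).factorization q else 0) :
    Qval k a c (a.gcd b) (a / a.gcd b) =
      (∏ p ∈ (a * c * Lk k).primeFactors, p ^ localExp k a b c p) * X := by
  have hL := Lk_ne_zero k
  have hcL : c * Lk k ≠ 0 := mul_ne_zero hc hL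
  have hacL : a * c * Lk k ≠ 0 := mul_ne_zero (mul_ne_zero ha hc) hL
  have hS : ∀ p ∈ (a * c * Lk k).primeFactors, p.Prime := fun p => Nat.prime_of_mem_primeFactors
  have hS' : ∀ p ∈ (a / a.gcd b).divisors.filter Nat.Prime, p.Prime := fun p hp =>
    (Finset.mem_filter.1 hp).2
  have ha' : a / a.gcd b ≠ 0 := fun h => by
    rcases Nat.div_eq_zero_iff.1 h with h | h
    · exact ha (Nat.gcd_eq_zero_iff.1 h).1
    · exact absurd (Nat.gcd_le_left b (Nat.pos_of_ne_zero ha)) (not_le.2 h)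
  have hE0 := Finset.prod_ne_zero_iff.2 fun p hp =>
    (pow_pos (hS p hp).pos (localExp k a b c p)).ne'
  have hR0 := Finset.prod_ne_zero_iff.2 fun p hp =>
    (pow_pos (hS' p hp).pos ((c * Lk k).factorization p)).ne'
  have heta0 : eta2 k a c (a.gcd b) (a / a.gcd b) ≠ 0 := by
    rw [eta2_eq ha hb hc]
    split_ifs <;> positivity
  rw [Qval, Finset.prod_congr rfl fun q hq => by rw [← Nat.factorization_def _ (hS' q hq)]]
  refine Nat.div_eq_of_eq_mul_left (Nat.pos_of_ne_zero (mul_ne_zero heta0 hR0)) ?_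
  refine Nat.eq_of_factorization_eq hcL
    (mul_ne_zero (mul_ne_zero hE0 hX0) (mul_ne_zero heta0 hR0)) fun q => ?_
  by_cases hq : q.Prime
  swap
  · simp [Nat.factorization_eq_zero_of_not_prime _ hq]
  have hmem : q ∉ (a * c * Lk k).primeFactors →
      c.factorization q = 0 ∧ (Lk k).factorization q = 0 := fun h => by
    have : ¬ q ∣ a * c * Lk k := fun h' => h (Nat.mem_primeFactors.2 ⟨hq, h', hacL⟩)
    have := Nat.factorization_eq_zero_of_not_dvd this
    rw [Nat.factorization_mul (mul_ne_zero ha hc) hL, Nat.factorization_mul ha hc] at this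
    simp only [Finsupp.add_apply] at this
    omega
  have heta : (eta2 k a c (a.gcd b) (a / a.gcd b)).factorization q = if q = 2 ∧
      ¬ b.factorization q < a.factorization q then
        c.factorization q + (Lk k).factorization q - localExp k a b c q else 0 := by
    rw [eta2_eq ha hb hc]
    by_cases h2 : q = 2
    · subst h2
      by_cases hab : b.factorization 2 < a.factorization 2
      · simp [hab]
      · simp [hab, Nat.prime_two.factorization_pow]
    · simp only [h2, false_and, if_false]
      by_cases hab : b.factorization 2 < a.factorization 2
      all_goals simp [hab, Nat.prime_two.factorization_pow, Ne.symm h2]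
  have hmem' : q ∈ (a / a.gcd b).divisors.filter Nat.Prime ↔
      b.factorization q < a.factorization q := by
    rw [Finset.mem_filter, Nat.mem_divisors, prime_dvd_div_gcd_iff hq ha hb]
    tauto
  rw [Nat.factorization_mul (mul_ne_zero hE0 hX0) (mul_ne_zero heta0 hR0),
    Nat.factorization_mul hE0 hX0, Nat.factorization_mul heta0 hR0]
  simp only [Finsupp.add_apply]
  rw [factorization_prod_prime_pow hS, factorization_prod_prime_pow hS', heta, hX q hq,
    Nat.factorization_mul hc hL, Finsupp.add_apply]
  simp only [hmem', localExp, truncLevel]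
  by_cases hqS : q ∈ (a * c * Lk k).primeFactors
  · simp only [hqS, if_true]
    clear heta hmem hmem' hX
    grind
  · obtain ⟨h1, h2⟩ := hmem hqS
    simp [h1, h2]

/-- Theorem 1.3: `g_{k,φ}` is periodic, and its smallest period equals
`Q_{k,a',c}` except when some odd prime `p ∤ a'` satisfies
`v_p (k + 1) ≥ v_p (L_k) ≥ 1`, in which case the smallest period is
`Q_{k,a',c} / p ^ v_p (L_k)`. -/
theorem smallest_period_gkphi (k a b c : ℕ)
    (hk : 1 ≤ k) (ha : 1 ≤ a) (hc : 1 ≤ c)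
    (d a' : ℕ) (hd : d = Nat.gcd a b) (ha' : a' = a / d) :
    (∃ T : ℕ, 0 < T ∧ ∀ n : ℕ, 0 < n →
      gkphi k a b c (n + T) = gkphi k a b c n) ∧
    ∀ P : ℕ, IsLeast {T : ℕ | 0 < T ∧ ∀ n : ℕ, 0 < n →
        gkphi k a b c (n + T) = gkphi k a b c n} P →
      ((∀ p : ℕ, p.Prime → p ≠ 2 → ¬ p ∣ a' →
          ¬(1 ≤ padicValNat p (Lk k) ∧
            padicValNat p (Lk k) ≤ padicValNat p (k + 1))) →
        P = Qval k a c d a') ∧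
      (∀ p : ℕ, p.Prime → p ≠ 2 → ¬ p ∣ a' →
          1 ≤ padicValNat p (Lk k) →
          padicValNat p (Lk k) ≤ padicValNat p (k + 1) →
        P = Qval k a c d a' / p ^ padicValNat p (Lk k)) := by
  obtain rfl := hd
  obtain rfl := ha'
  have ha0 : a ≠ 0 := by omega
  have hb0 : b + a ≠ 0 := by omega
  have hc0 : c ≠ 0 := by omega
  rw [← Nat.gcd_add_self_right a b]
  set S := (a * c * Lk k).primeFactors with hS
  have hSp : ∀ p ∈ S, p.Prime := fun p => Nat.prime_of_mem_primeFactors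
  set E := ∏ p ∈ S, p ^ localExp k a (b + a) c p with hE
  have hE0 : 0 < E := Finset.prod_pos fun p hp => pow_pos (hSp p hp).pos _
  have hiff : ∀ T, (∀ n, 0 < n → gkphi k a b c (n + T) = gkphi k a b c n) ↔
      Function.Periodic (fun n => ∏ p ∈ S, localFactor k a (b + a) c p n) T := fun T => by
    simp only [Function.Periodic, hS, ← gkphi_succ (b := b) ha0 hc0]
    refine ⟨fun h n => ?_, fun h n hn => ?_⟩
    · rw [add_right_comm]
      exact h _ n.succ_pos
    · obtain ⟨n, rfl⟩ := Nat.exists_eq_succ_of_ne_zero hn.ne'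
      rw [Nat.succ_eq_add_one, add_right_comm]
      exact h n
  have hEper : Function.Periodic (fun n => ∏ p ∈ S, localFactor k a (b + a) c p n) E := fun n =>
    Finset.prod_congr rfl fun p hp =>
      (localFactor_periodic_localExp (hSp p hp) ha0 hb0 hc0).of_dvd
        (Finset.dvd_prod_of_mem (fun p => p ^ localExp k a (b + a) c p) hp) n
  refine ⟨⟨E, hE0, (hiff E).2 hEper⟩, fun P hP => ?_⟩
  have hPE : P = E := by
    refine le_antisymm (hP.2 ⟨hE0, (hiff E).2 hEper⟩) (Nat.le_of_dvd hP.1.1 ?_)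
    exact prod_pow_dvd_of_periodic hSp (fun p hp n => localFactor_pos (hSp p hp) _ _ _ _ n)
      (fun p hp => localFactor_periodic_localExp (hSp p hp) ha0 hb0 hc0)
      (fun p hp => not_periodic_localExp_sub_one hk (hSp p hp) ha0 hb0 hc0) ((hiff P).1 hP.1.2)
  refine ⟨fun h => ?_, fun p hp hp2 hpa h1 h2 => ?_⟩
  · rw [Qval_eq ha0 hb0 hc0 one_ne_zero, hPE, mul_one]
    intro q hq
    rw [if_neg, Nat.factorization_one, Finsupp.zero_apply]
    rintro ⟨hq2, hqa, h1, h2⟩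
    refine h q hq hq2 (fun h => hqa ((prime_dvd_div_gcd_iff hq ha0 hb0).1 h)) ?_
    rw [← Nat.factorization_def _ hq, ← Nat.factorization_def _ hq]
    exact ⟨h1, h2⟩
  · rw [← Nat.factorization_def _ hp] at h1 h2 ⊢
    rw [← Nat.factorization_def _ hp] at h2
    have hX0 : p ^ (Lk k).factorization p ≠ 0 := (pow_pos hp.pos _).ne'
    rw [Qval_eq ha0 hb0 hc0 hX0, hPE, Nat.mul_div_cancel _ (Nat.pos_of_ne_zero hX0)]
    intro q hq
    rw [hp.factorization_pow, Finsupp.single_apply]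
    by_cases hpq : p = q
    · subst hpq
      rw [prime_dvd_div_gcd_iff hp ha0 hb0] at hpa
      rw [if_pos rfl, if_pos ⟨hp2, hpa, h1, h2⟩]
    · rw [if_neg hpq, if_neg]
      rintro ⟨-, -, h3, h4⟩
      exact hpq (exceptional_prime_unique hp hq h1 h2 h3 h4)
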